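/- arXiv:1411.1864 — 7 statements merged into one kernel-verified Lean document; each statement's English description precedes it below -/
import Mathlib

section
/- Let L be the weighted Laplacian matrix of a connected weighted undirected graph on n vertices, let F = diag(f₁,…,fₙ) with fᵢ > 0, and let Iⁱⁿʲ ∈ ℝⁿ. A pair (u, V) ∈ ℝⁿ × ℝⁿ satisfying the constraint L V = Iⁱⁿʲ + u minimizes the cost Σᵢ ½ fᵢ uᵢ² over all pairs satisfying this constraint if and only if u = μ F⁻¹ 1ₙ, where μ = −(Σᵢ Iⁱⁿʲᵢ)/(Σᵢ fᵢ⁻¹). -/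
open Matrix Finset


lemma aux_sum (n : ℕ) (L : Matrix (Fin n) (Fin n) ℝ) (hsym : L.IsSymm)
    (hL1 : L *ᵥ (fun _ => (1 : ℝ)) = 0) (x : Fin n → ℝ) : ∑ i, (L *ᵥ x) i = 0 := by
  have h : (fun _ => (1 : ℝ)) ⬝ᵥ (L *ᵥ x) = 0 := by
    rw [Matrix.dotProduct_mulVec, ← Matrix.mulVec_transpose, hsym.eq, hL1, zero_dotProduct]
  simpa [dotProduct] using h

lemma aux_solve (n : ℕ) (hn : 0 < n) (L : Matrix (Fin n) (Fin n) ℝ) (hsym : L.IsSymm)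
    (hL1 : L *ᵥ (fun _ => (1 : ℝ)) = 0)
    (hker : ∀ x : Fin n → ℝ, L *ᵥ x = 0 → ∃ c : ℝ, x = fun _ => c)
    (b : Fin n → ℝ) (hb : ∑ i, b i = 0) : ∃ x, L *ᵥ x = b := by
  have hn' : (n : ℝ) ≠ 0 := by exact_mod_cast hn.ne'
  let A : Matrix (Fin n) (Fin n) ℝ := L + Matrix.of fun _ _ => 1
  have hA : ∀ x i, (A *ᵥ x) i = (L *ᵥ x) i + ∑ j, x j := by
    intro x i
    simp [A, Matrix.mulVec, dotProduct, add_mul, Finset.sum_add_distrib]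
  have key : ∀ x b, ∑ i, b i = 0 → A *ᵥ x = b → ∑ j, x j = 0 ∧ L *ᵥ x = b := by
    intro x b hb hx
    have h1 : ∑ i, (A *ᵥ x) i = n * ∑ j, x j := by
      simp only [hA, Finset.sum_add_distrib, aux_sum n L hsym hL1]
      simp
    rw [hx, hb] at h1
    have h2 : ∑ j, x j = 0 := by
      rcases mul_eq_zero.mp h1.symm with h | h
      · exact absurd h hn'
      · exact h
    refine ⟨h2, ?_⟩
    ext i
    rw [← hx, hA, h2, add_zero]
  have hinj : Function.Injective A.mulVecLin := by
    rw [← LinearMap.ker_eq_bot, LinearMap.ker_eq_bot']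
    intro x hx
    obtain ⟨h1, h2⟩ := key x 0 (by simp) (by simpa using hx)
    obtain ⟨c, rfl⟩ := hker x h2
    simp [hn'] at h1
    ext i
    simpa using h1
  obtain ⟨x, hx⟩ := (LinearMap.injective_iff_surjective.mp hinj) b
  exact ⟨x, (key x b hb (by simpa using hx)).2⟩

/-- A feasible pair `(u, V)` with `L V = Iⁱⁿʲ + u` minimizes
`Σᵢ ½ fᵢ uᵢ²` over all feasible pairs iff `u = μ F⁻¹ 1ₙ` with
`μ = −(Σᵢ Iⁱⁿʲᵢ)/(Σᵢ fᵢ⁻¹)`. -/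
theorem stmt_1 (n : ℕ) (L : Matrix (Fin n) (Fin n) ℝ)
    (hsym : L.IsSymm) (hpsd : L.PosSemidef)
    (hL1 : L *ᵥ (fun _ => (1 : ℝ)) = 0)
    (hker : ∀ x : Fin n → ℝ, L *ᵥ x = 0 → ∃ c : ℝ, x = fun _ => c)
    (f : Fin n → ℝ) (hf : ∀ i, 0 < f i)
    (Iinj : Fin n → ℝ) (u V : Fin n → ℝ)
    (hfeas : L *ᵥ V = Iinj + u) :
    ((∀ u' V' : Fin n → ℝ, L *ᵥ V' = Iinj + u' →
        ∑ i, (1 / 2) * f i * (u i) ^ 2 ≤ ∑ i, (1 / 2) * f i * (u' i) ^ 2) ↔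
      u = (-(∑ i, Iinj i) / (∑ i, (f i)⁻¹)) • fun i => (f i)⁻¹) := by
  rcases Nat.eq_zero_or_pos n with rfl | hn
  · constructor
    · intro _
      exact Subsingleton.elim _ _
    · intro _ u' V' _
      simp
  haveI : Nonempty (Fin n) := ⟨⟨0, hn⟩⟩
  have hpos : 0 < ∑ i, (f i)⁻¹ :=
    Finset.sum_pos (fun i _ => inv_pos.mpr (hf i)) Finset.univ_nonempty
  have hsum : ∀ u' V' : Fin n → ℝ, L *ᵥ V' = Iinj + u' → ∑ i, u' i = -∑ i, Iinj i := by
    intro u' V' h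
    have h1 := aux_sum n L hsym hL1 V'
    rw [h] at h1
    simp only [Pi.add_apply, Finset.sum_add_distrib] at h1
    linarith
  set m : ℝ := -(∑ i, Iinj i) / (∑ i, (f i)⁻¹) with hm
  have hw : ∑ i, m * (f i)⁻¹ = -∑ i, Iinj i := by
    rw [← Finset.mul_sum, hm, div_mul_cancel₀ _ hpos.ne']
  have hdec : ∀ u' V' : Fin n → ℝ, L *ᵥ V' = Iinj + u' →
      ∑ i, (1 / 2) * f i * (u' i) ^ 2 = ∑ i, (1 / 2) * f i * (m * (f i)⁻¹) ^ 2
        + ∑ i, (1 / 2) * f i * (u' i - m * (f i)⁻¹) ^ 2 := by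
    intro u' V' h
    have h1 : ∑ i, m * (u' i - m * (f i)⁻¹) = 0 := by
      rw [← Finset.mul_sum, Finset.sum_sub_distrib, hw, hsum u' V' h]
      ring
    rw [← add_zero (_ + _), ← h1, ← Finset.sum_add_distrib, ← Finset.sum_add_distrib]
    refine Finset.sum_congr rfl fun i _ => ?_
    have := (hf i).ne'
    field_simp
    ring
  have hnn : ∀ u' : Fin n → ℝ, ∀ i ∈ Finset.univ,
      0 ≤ (1 / 2) * f i * (u' i - m * (f i)⁻¹) ^ 2 := by
    intro u' i _
    have := hf i
    positivity
  constructor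
  · intro hmin
    obtain ⟨x, hx⟩ := aux_solve n hn L hsym hL1 hker (Iinj + fun i => m * (f i)⁻¹) (by
      simp only [Pi.add_apply, Finset.sum_add_distrib, hw]
      ring)
    have h1 := hmin _ x hx
    rw [hdec u V hfeas] at h1
    have h2 := (Finset.sum_eq_zero_iff_of_nonneg (hnn u)).mp
      (le_antisymm (by linarith) (Finset.sum_nonneg (hnn u)))
    ext i
    have h3 := h2 i (Finset.mem_univ i)
    have h4 := hf i
    have h5 : u i - m * (f i)⁻¹ = 0 := by
      rcases mul_eq_zero.mp h3 with h | h
      · linarith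
      · exact pow_eq_zero_iff two_ne_zero |>.mp h
    simp only [Pi.smul_apply, smul_eq_mul]
    linarith
  · intro hu u' V' h
    rw [hdec u' V' h]
    have h1 := Finset.sum_nonneg (hnn u')
    rw [hu]
    simp only [Pi.smul_apply, smul_eq_mul]
    linarith
end

section
/- Let L ∈ ℝ^{n×n} be symmetric positive semidefinite, and let E = diag(e₁,…,eₙ) and K = diag(k₁,…,kₙ) be diagonal matrices with eᵢ > 0 and kᵢ > 0 for all i. Then the matrix A = −E(L + K) is Hurwitz, i.e., every complex eigenvalue of A has strictly negative real part. -/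
open Matrix

/-- For `L` symmetric positive semidefinite and positive diagonal
`E`, `K`, the matrix `A = −E(L + K)` is Hurwitz. -/
theorem stmt_3 (n : ℕ) (L : Matrix (Fin n) (Fin n) ℝ) (hL : L.PosSemidef)
    (e k : Fin n → ℝ) (he : ∀ i, 0 < e i) (hk : ∀ i, 0 < k i) :
    ∀ s : ℂ,
      s ∈ spectrum ℂ
        ((-(Matrix.diagonal e * (L + Matrix.diagonal k))).map (fun x => (x : ℂ))) →
      s.re < 0 := by
  intro s hs
  have hM : (L + Matrix.diagonal k).PosDef :=
    Matrix.PosDef.posSemidef_add hL (Matrix.PosDef.diagonal hk)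
  generalize L + Matrix.diagonal k = M at hs hM
  rw [← Matrix.spectrum_toLin', ← Module.End.hasEigenvalue_iff_mem_spectrum] at hs
  obtain ⟨v, hv⟩ := hs.exists_hasEigenvector
  have hv0 := hv.2
  have hv1 := hv.apply_eq_smul
  rw [Matrix.toLin'_apply] at hv1
  have key : ∀ i, -(∑ j, ((e i * M i j : ℝ) : ℂ) * v j) = s * v i := by
    intro i
    have h := congrFun hv1 i
    simpa [Matrix.mulVec, dotProduct, Matrix.diagonal_mul] using h
  set a : Fin n → ℝ := fun i => (v i).re with ha
  set b : Fin n → ℝ := fun i => (v i).im with hb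
  have hre : ∀ i, e i * (M *ᵥ a) i = -(s.re * a i - s.im * b i) := by
    intro i
    have h := congrArg Complex.re (key i)
    simp only [Complex.neg_re, Complex.re_sum, Complex.re_ofReal_mul, Complex.mul_re s] at h
    simp only [Matrix.mulVec, dotProduct, Finset.mul_sum, ha, hb, ← h, neg_neg, mul_assoc]
  have him : ∀ i, e i * (M *ᵥ b) i = -(s.re * b i + s.im * a i) := by
    intro i
    have h := congrArg Complex.im (key i)
    simp only [Complex.neg_im, Complex.im_sum, Complex.im_ofReal_mul, Complex.mul_im s] at h
    simp only [Matrix.mulVec, dotProduct, Finset.mul_sum, ha, hb, ← h, neg_neg, mul_assoc]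
  have hsum : a ⬝ᵥ (M *ᵥ a) + b ⬝ᵥ (M *ᵥ b)
      = -s.re * ∑ i, (a i ^ 2 + b i ^ 2) / e i := by
    simp only [dotProduct, ← Finset.sum_add_distrib, Finset.mul_sum]
    refine Finset.sum_congr rfl fun i _ => ?_
    have hei := (he i).ne'
    field_simp
    linear_combination a i * hre i + b i * him i
  have hnn : 0 ≤ ∑ i, (a i ^ 2 + b i ^ 2) / e i :=
    Finset.sum_nonneg fun i _ => div_nonneg (by positivity) (he i).le
  have hA : 0 ≤ a ⬝ᵥ (M *ᵥ a) := by
    simpa using hM.posSemidef.dotProduct_mulVec_nonneg a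
  have hB : 0 ≤ b ⬝ᵥ (M *ᵥ b) := by
    simpa using hM.posSemidef.dotProduct_mulVec_nonneg b
  have hpos : 0 < a ⬝ᵥ (M *ᵥ a) + b ⬝ᵥ (M *ᵥ b) := by
    by_cases h0 : a = 0
    · have hb0 : b ≠ 0 := by
        intro h1
        exact hv0 (funext fun i => Complex.ext (congrFun h0 i) (congrFun h1 i))
      have : 0 < b ⬝ᵥ (M *ᵥ b) := by simpa using hM.dotProduct_mulVec_pos hb0
      linarith
    · have : 0 < a ⬝ᵥ (M *ᵥ a) := by simpa using hM.dotProduct_mulVec_pos h0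
      linarith
  by_contra hc
  push Not at hc
  nlinarith [mul_nonneg hc hnn]
end

section
/- Let L be the weighted Laplacian matrix of a connected weighted undirected graph on n vertices, let K = diag(k₁,…,kₙ) with kᵢ > 0, and let I ∈ ℝⁿ satisfy Iᵢ ≤ 0 for all i with Iⱼ < 0 for at least one j. If V̄ ∈ ℝⁿ satisfies (L + K) V̄ = I, then V̄ᵢ < 0 for every i. (Hence, under uniform nominal voltage Vⁿᵒᵐ = vⁿᵒᵐ·1ₙ, the droop-controlled equilibrium voltage V = vⁿᵒᵐ·1ₙ + V̄ lies strictly below the nominal voltage at every bus, so the quadratic voltage-deviation cost cannot be minimized.) -/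
open Matrix Finset

/-- If `(L + K) V̄ = I` with `I ≤ 0`, `I ≠ 0`, `L` a connected
weighted Laplacian and `K` positive diagonal, then `V̄ᵢ < 0` for every `i`. -/
theorem stmt_5 (n : ℕ) (L : Matrix (Fin n) (Fin n) ℝ)
    (hsym : L.IsSymm) (hoff : ∀ i j, i ≠ j → L i j ≤ 0)
    (hL1 : L *ᵥ (fun _ => (1 : ℝ)) = 0)
    (hker : ∀ x : Fin n → ℝ, L *ᵥ x = 0 → ∃ c : ℝ, x = fun _ => c)
    (k : Fin n → ℝ) (hk : ∀ i, 0 < k i)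
    (I : Fin n → ℝ) (hI : ∀ i, I i ≤ 0) (hIneg : ∃ j, I j < 0)
    (Vb : Fin n → ℝ) (hVb : (L + Matrix.diagonal k) *ᵥ Vb = I) :
    ∀ i, Vb i < 0 := by
  have hrow : ∀ i, ∑ j, L i j = 0 := by
    intro i
    have h := congrFun hL1 i
    simpa [Matrix.mulVec, dotProduct] using h
  have heq : ∀ i, ∑ j, L i j * Vb j + k i * Vb i = I i := by
    intro i
    have h := congrFun hVb i
    rw [Matrix.add_mulVec, Pi.add_apply, Matrix.mulVec_diagonal] at h
    simpa [Matrix.mulVec, dotProduct] using h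
  have hle : ∀ i, Vb i ≤ 0 := by
    obtain ⟨j0, -⟩ := hIneg
    obtain ⟨m, -, hm⟩ := Finset.exists_max_image Finset.univ Vb ⟨j0, Finset.mem_univ _⟩
    have h1 : 0 ≤ ∑ j, L m j * (Vb j - Vb m) := by
      apply Finset.sum_nonneg
      intro j _
      by_cases h : m = j
      · subst h; simp
      · exact mul_nonneg_of_nonpos_of_nonpos (hoff m j h)
          (sub_nonpos.mpr (hm j (Finset.mem_univ _)))
    have h2 : ∑ j, L m j * (Vb j - Vb m) = ∑ j, L m j * Vb j := by
      simp only [mul_sub, Finset.sum_sub_distrib, ← Finset.sum_mul, hrow]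
      simp
    have h3 : k m * Vb m ≤ 0 := by linarith [heq m, hI m]
    have h4 : Vb m ≤ 0 := by
      by_contra hc
      push Not at hc
      linarith [mul_pos (hk m) hc]
    intro i
    exact (hm i (Finset.mem_univ _)).trans h4
  have hz : ∀ i j, Vb i = 0 → Vb j ≠ 0 → L i j = 0 := by
    intro i j hi hj
    have hnn : ∀ l ∈ Finset.univ, 0 ≤ L i l * Vb l := by
      intro l _
      by_cases h : i = l
      · subst h; simp [hi]
      · exact mul_nonneg_of_nonpos_of_nonpos (hoff i l h) (hle l)
    have h0 : ∑ l, L i l * Vb l = 0 := by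
      apply le_antisymm _ (Finset.sum_nonneg hnn)
      have := heq i
      rw [hi] at this
      linarith [hI i]
    have := (Finset.sum_eq_zero_iff_of_nonneg hnn).mp h0 j (Finset.mem_univ _)
    exact (mul_eq_zero.mp this).resolve_right hj
  intro i
  refine lt_of_le_of_ne (hle i) fun hi => ?_
  obtain ⟨c, hc⟩ := hker (fun j => if Vb j = 0 then 1 else 0) (by
    funext a
    simp only [Matrix.mulVec, dotProduct, Pi.zero_apply]
    by_cases ha : Vb a = 0
    · refine Eq.trans ?_ (hrow a)
      refine Finset.sum_congr rfl fun j _ => ?_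
      by_cases hj : Vb j = 0
      · simp [hj]
      · simp [hz a j ha hj]
    · refine Finset.sum_eq_zero fun j _ => ?_
      by_cases hj : Vb j = 0
      · rw [← hsym.apply a j, hz j a hj ha, zero_mul]
      · simp [hj])
  have hc1 : c = 1 := by
    have := congrFun hc i
    simpa [hi] using this.symm
  have hall : ∀ j, Vb j = 0 := by
    intro j
    by_contra hj
    have := congrFun hc j
    simp [hj, hc1] at this
  obtain ⟨j, hj⟩ := hIneg
  have := heq j
  simp [hall] at this
  linarith
end

section
/- Let L_c be the weighted Laplacian matrix of a connected weighted undirected graph on n vertices, let γ > 0, let Kᵛ = diag(k₁ᵛ, 0, …, 0) with k₁ᵛ > 0, and let Vⁿᵒᵐ ∈ ℝ. If V̂, V ∈ ℝⁿ satisfy the equilibrium equation 0 = Kᵛ(Vⁿᵒᵐ·1ₙ − V) − γ L_c (V̂ − V), then V₁ = Vⁿᵒᵐ and there exists k ∈ ℝ such that V − V̂ = k·1ₙ. (Consequently, the equilibrium control u = Kᴾ(V̂ − V) of distributed averaging controller I is proportional to Kᴾ1ₙ, so with Kᴾ = F⁻¹ it equals the optimal injection, and the voltage at bus 1 equals its nominal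 value.) -/
open Matrix

/-- At equilibrium of distributed averaging controller I,
`0 = Kᵛ(Vⁿᵒᵐ1ₙ − V) − γL_c(V̂ − V)` implies `V₁ = Vⁿᵒᵐ` and
`V − V̂ = k·1ₙ` for some `k`. -/
theorem stmt_12 (n : ℕ) (hn : 0 < n) (Lc : Matrix (Fin n) (Fin n) ℝ)
    (hsym : Lc.IsSymm) (hpsd : Lc.PosSemidef)
    (hLc1 : Lc *ᵥ (fun _ => (1 : ℝ)) = 0)
    (hker : ∀ x : Fin n → ℝ, Lc *ᵥ x = 0 → ∃ c : ℝ, x = fun _ => c)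
    (γ : ℝ) (hγ : 0 < γ) (kv1 : ℝ) (hkv1 : 0 < kv1) (Vnom : ℝ)
    (Vhat V : Fin n → ℝ)
    (heq : 0 = Matrix.diagonal (fun i => if i = ⟨0, hn⟩ then kv1 else 0) *ᵥ
        ((fun _ => Vnom) - V) - γ • (Lc *ᵥ (Vhat - V))) :
    V ⟨0, hn⟩ = Vnom ∧ ∃ k : ℝ, V - Vhat = fun _ => k := by
  have hsum : ∀ x : Fin n → ℝ, ∑ i, (Lc *ᵥ x) i = 0 := by
    intro x
    have h1 : (fun _ => (1 : ℝ)) ⬝ᵥ (Lc *ᵥ x) = 0 := by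
      rw [Matrix.dotProduct_mulVec, ← Matrix.mulVec_transpose, hsym.eq, hLc1, zero_dotProduct]
    simpa [dotProduct] using h1
  have hpt : ∀ i, (if i = ⟨0, hn⟩ then kv1 else 0) * (Vnom - V i)
      = γ * (Lc *ᵥ (Vhat - V)) i := by
    intro i
    have h := congrFun heq i
    simp only [Pi.zero_apply, Pi.sub_apply, Matrix.mulVec_diagonal, Pi.smul_apply,
      smul_eq_mul] at h
    linarith
  have hV : V ⟨0, hn⟩ = Vnom := by
    have h : ∑ i, (if i = ⟨0, hn⟩ then kv1 else 0) * (Vnom - V i) = 0 := by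
      rw [Finset.sum_congr rfl (fun i _ => hpt i), ← Finset.mul_sum, hsum, mul_zero]
    simp only [ite_mul, zero_mul, Finset.sum_ite_eq', Finset.mem_univ, if_true] at h
    rcases mul_eq_zero.mp h with h | h <;> linarith
  refine ⟨hV, ?_⟩
  have hL : Lc *ᵥ (Vhat - V) = 0 := by
    funext i
    have h := hpt i
    have h0 : (if i = ⟨0, hn⟩ then kv1 else 0) * (Vnom - V i) = 0 := by
      split_ifs with hi
      · rw [hi, hV]; ring
      · ring
    rw [h0] at h
    exact (mul_eq_zero.mp h.symm).resolve_left hγ.ne'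
  obtain ⟨c, hc⟩ := hker _ hL
  refine ⟨-c, ?_⟩
  funext i
  have h := congrFun hc i
  simp only [Pi.sub_apply] at h ⊢
  linarith
end

section
/- Let L_c be the weighted Laplacian matrix of a connected weighted undirected graph on n vertices, let γ > 0, kᵛ > 0, and let Vⁿᵒᵐ ∈ ℝⁿ. If V̂, V ∈ ℝⁿ satisfy the equilibrium equation 0 = kᵛ·1ₙ1ₙᵀ(Vⁿᵒᵐ − V) − γ L_c (V̂ − V), then Σᵢ (Vⁿᵒᵐᵢ − Vᵢ) = 0 and there exists k ∈ ℝ such that V − V̂ = k·1ₙ. (Consequently, at equilibrium of distributed averaging controller II the control u = Kᴾ(V̂ − V) is proportional to Kᴾ1ₙ, and the unweighted sum of voltage deviations from nominal vanishes, minimizing the uniform quadratic voltage-deviation cost.) -/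
open Matrix Finset

/-- At equilibrium of distributed averaging controller II,
`0 = kᵛ·1ₙ1ₙᵀ(Vⁿᵒᵐ − V) − γL_c(V̂ − V)` implies `Σᵢ (Vⁿᵒᵐᵢ − Vᵢ) = 0` and
`V − V̂ = k·1ₙ` for some `k`. -/
theorem stmt_14 (n : ℕ) (Lc : Matrix (Fin n) (Fin n) ℝ)
    (hsym : Lc.IsSymm) (hpsd : Lc.PosSemidef)
    (hLc1 : Lc *ᵥ (fun _ => (1 : ℝ)) = 0)
    (hker : ∀ x : Fin n → ℝ, Lc *ᵥ x = 0 → ∃ c : ℝ, x = fun _ => c)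
    (γ : ℝ) (hγ : 0 < γ) (kv : ℝ) (hkv : 0 < kv) (Vnom : Fin n → ℝ)
    (Vhat V : Fin n → ℝ)
    (heq : 0 = kv • ((Matrix.of fun _ _ => (1 : ℝ)) *ᵥ (Vnom - V))
        - γ • (Lc *ᵥ (Vhat - V))) :
    ∑ i, (Vnom i - V i) = 0 ∧ ∃ k : ℝ, V - Vhat = fun _ => k := by
  have hrow : ∀ i, kv * ∑ j, (Vnom j - V j) = γ * (Lc *ᵥ (Vhat - V)) i := by
    intro i
    have h := congrFun heq i
    have h1 : ((Matrix.of fun (_ : Fin n) (_ : Fin n) => (1 : ℝ)) *ᵥ (Vnom - V)) i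
        = ∑ j, (Vnom j - V j) := by
      simp [Matrix.mulVec, dotProduct]
    rw [Pi.sub_apply, Pi.smul_apply, Pi.smul_apply, h1] at h
    simp only [Pi.zero_apply, smul_eq_mul] at h
    linarith
  have hone : ∑ i, (Lc *ᵥ (Vhat - V)) i = 0 := by
    have h : (fun _ => (1 : ℝ)) ⬝ᵥ (Lc *ᵥ (Vhat - V)) = 0 := by
      rw [Matrix.dotProduct_mulVec, ← Matrix.mulVec_transpose, hsym.eq, hLc1, zero_dotProduct]
    simpa [dotProduct] using h
  have hS : ∑ i, (Vnom i - V i) = 0 := by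
    rcases Nat.eq_zero_or_pos n with hn | hn
    · subst hn
      exact Fin.sum_univ_zero _
    · have h : ∑ _i : Fin n, kv * ∑ j, (Vnom j - V j) = 0 := by
        rw [Finset.sum_congr rfl (fun i _ => hrow i), ← Finset.mul_sum, hone, mul_zero]
      rw [Finset.sum_const, Finset.card_univ, Fintype.card_fin, nsmul_eq_mul] at h
      have hn' : (n : ℝ) ≠ 0 := by exact_mod_cast hn.ne'
      exact (mul_eq_zero.mp ((mul_eq_zero.mp h).resolve_left hn')).resolve_left hkv.ne'
  refine ⟨hS, ?_⟩
  have hL : Lc *ᵥ (Vhat - V) = 0 := by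
    funext i
    have h := hrow i
    rw [hS, mul_zero] at h
    exact (mul_eq_zero.mp h.symm).resolve_left hγ.ne'
  obtain ⟨c, hc⟩ := hker _ hL
  refine ⟨-c, ?_⟩
  funext i
  have h := congrFun hc i
  simp only [Pi.sub_apply] at h ⊢
  linarith
end

section
/- Let L_c be the weighted Laplacian matrix of a connected weighted undirected graph on n vertices, let Kᵛ = diag(g₁,…,gₙ) with gᵢ ≥ 0, let γ, δ > 0, and let Vⁿᵒᵐ ∈ ℝⁿ. If V̄, V̂, V ∈ ℝⁿ satisfy the equilibrium equations 0 = −γ L_c (V̂ + V̄ − V) and 0 = −Kᵛ(V − Vⁿᵒᵐ) − δ L_c V̄, then Σᵢ gᵢ (Vᵢ − Vⁿᵒᵐᵢ) = 0 and there exists k ∈ ℝ such that V̂ + V̄ − V = k·1ₙ. (Consequently, at equilibrium of distributed averaging controller III the control u = −Kᴾ(V − V̂ − V̄) is proportional to Kᴾ1ₙ, so with Kᴾ = F⁻¹ it is the optimal injection, and the weighted quadratic voltage-deviation cost Σᵢ ½gᵢ(Vⁿᵒᵐᵢ − Vᵢ)² is minimized.) -/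
open Matrix Finset

/-- At equilibrium of distributed averaging controller III,
`0 = −γL_c(V̂ + V̄ − V)` and `0 = −Kᵛ(V − Vⁿᵒᵐ) − δL_cV̄` imply
`Σᵢ gᵢ (Vᵢ − Vⁿᵒᵐᵢ) = 0` and `V̂ + V̄ − V = k·1ₙ` for some `k`. -/
theorem stmt_16 (n : ℕ) (Lc : Matrix (Fin n) (Fin n) ℝ)
    (hsym : Lc.IsSymm) (hpsd : Lc.PosSemidef)
    (hLc1 : Lc *ᵥ (fun _ => (1 : ℝ)) = 0)
    (hker : ∀ x : Fin n → ℝ, Lc *ᵥ x = 0 → ∃ c : ℝ, x = fun _ => c)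
    (g : Fin n → ℝ) (hg : ∀ i, 0 ≤ g i)
    (γ δ : ℝ) (hγ : 0 < γ) (hδ : 0 < δ) (Vnom : Fin n → ℝ)
    (Vbar Vhat V : Fin n → ℝ)
    (heq1 : 0 = -(γ • (Lc *ᵥ (Vhat + Vbar - V))))
    (heq2 : 0 = -(Matrix.diagonal g *ᵥ (V - Vnom)) - δ • (Lc *ᵥ Vbar)) :
    ∑ i, g i * (V i - Vnom i) = 0 ∧
      ∃ k : ℝ, Vhat + Vbar - V = fun _ => k := by
  constructor
  · have h0 : (fun _ => (1 : ℝ)) ⬝ᵥ (Lc *ᵥ Vbar) = 0 := by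
      rw [Matrix.dotProduct_mulVec, ← Matrix.mulVec_transpose, hsym.eq, hLc1, zero_dotProduct]
    have h1 : ∑ i, (Lc *ᵥ Vbar) i = 0 := by
      simpa [dotProduct] using h0
    have h2 : ∀ i, g i * (V i - Vnom i) = -δ * (Lc *ᵥ Vbar) i := by
      intro i
      have h := congrFun heq2 i
      simp only [Pi.zero_apply, Pi.sub_apply, Pi.neg_apply, Pi.smul_apply, smul_eq_mul,
        Matrix.mulVec_diagonal] at h
      linarith
    rw [Finset.sum_congr rfl (fun i _ => h2 i), ← Finset.mul_sum, h1, mul_zero]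
  · apply hker
    have h := neg_eq_zero.mp heq1.symm
    exact (smul_eq_zero.mp h).resolve_left hγ.ne'
end

section
/- Let L_R, L_c ∈ ℝ^{n×n} be symmetric matrices, let Kᴾ, C ∈ ℝ^{n×n} be positive diagonal matrices with E = C⁻¹, let γ > 0, and let Kᵛ ∈ ℝ^{n×n} be any matrix. Define the 2n×2n block matrix A = [[−γL_c, γL_c − Kᵛ], [EKᴾ, −E(L_R + Kᴾ)]] and, for s ∈ ℂ, the n×n matrix Q(s) = s²·(Kᴾ)⁻¹C + s·((Kᴾ)⁻¹L_R + Iₙ + γL_c(Kᴾ)⁻¹C) + γL_c(Kᴾ)⁻¹L_R + Kᵛ. Then for every s ∈ ℂ, det(s·I_{2n} − A) = det(EKᴾ)·det(Q(s)). In particular, s is an eigenvalue of A if and only if det(Q(s)) = 0. -/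
open Matrix


lemma aux_det {n : ℕ} (a b c' d X F : Matrix (Fin n) (Fin n) ℂ) (h : F * X = 1) (hc : c' = -F) :
    (Matrix.fromBlocks a b c' d).det = F.det * (a * (X * d) + b).det := by
  subst hc
  have h1 : Matrix.fromBlocks a b (-F) d *
      (Matrix.fromBlocks 1 (X * d) 0 1 * (Matrix.fromBlocks 1 (-1) 0 1 *
        (Matrix.fromBlocks 1 0 1 1 * Matrix.fromBlocks 1 (-1) 0 1)))
      = Matrix.fromBlocks (a * (X * d) + b) (-a) 0 F := by
    have h2 : F * (X * d) = d := by rw [← Matrix.mul_assoc, h, Matrix.one_mul]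
    simp [Matrix.fromBlocks_multiply, h2, Matrix.mul_add]
  have h3 := congrArg Matrix.det h1
  simp only [Matrix.det_mul, Matrix.det_fromBlocks_zero₂₁, Matrix.det_fromBlocks_zero₁₂,
    Matrix.det_one, mul_one] at h3
  rw [h3, mul_comm]

lemma aux_alg {n : ℕ} (s : ℂ) (G R K E P Pi C : Matrix (Fin n) (Fin n) ℂ)
    (hCE : C * E = 1) (hP : Pi * P = 1) :
    (s • 1 + G) * (Pi * C * (s • 1 + E * (R + P))) + (K - G)
      = s ^ 2 • (Pi * C) + s • (Pi * R + 1 + G * Pi * C) + (G * Pi * R + K) := by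
  have h : Pi * C * (s • 1 + E * (R + P)) = s • (Pi * C) + Pi * R + 1 := by
    have : Pi * C * (E * (R + P)) = Pi * (C * E) * (R + P) := by noncomm_ring
    rw [mul_add, this, hCE, mul_one, mul_add, hP, mul_smul_comm, mul_one, add_assoc]
  rw [h]
  simp only [add_mul, mul_add, smul_mul_assoc, mul_smul_comm, one_mul, mul_one, smul_add,
    smul_smul, pow_two, mul_assoc]
  abel

/-- The characteristic determinant identity
`det(sI₂ₙ − A) = det(EKᴾ)·det(Q(s))` for the closed-loop matrix of the
distributed averaging controllers, where
`Q(s) = s²(Kᴾ)⁻¹C + s((Kᴾ)⁻¹L_R + Iₙ + γL_c(Kᴾ)⁻¹C) + γL_c(Kᴾ)⁻¹L_R + Kᵛ`;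
in particular `s` is an eigenvalue of `A` iff `det(Q(s)) = 0`. -/
theorem stmt_19 (n : ℕ)
    (LR Lc : Matrix (Fin n) (Fin n) ℝ)
    (hLRsym : LR.IsSymm) (hLcsym : Lc.IsSymm)
    (kp c : Fin n → ℝ) (hkp : ∀ i, 0 < kp i) (hc : ∀ i, 0 < c i)
    (γ : ℝ) (hγ : 0 < γ) (Kv : Matrix (Fin n) (Fin n) ℝ) :
    let Kp := Matrix.diagonal kp
    let C := Matrix.diagonal c
    let E := C⁻¹
    let A : Matrix (Fin n ⊕ Fin n) (Fin n ⊕ Fin n) ℝ :=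
      Matrix.fromBlocks (-(γ • Lc)) (γ • Lc - Kv) (E * Kp) (-(E * (LR + Kp)))
    let A' := A.map (fun x => (x : ℂ))
    let Q : ℂ → Matrix (Fin n) (Fin n) ℂ := fun s =>
      s ^ 2 • (Kp⁻¹ * C).map (fun x => (x : ℂ))
        + s • ((Kp⁻¹ * LR + 1 + γ • (Lc * Kp⁻¹ * C)).map (fun x => (x : ℂ)))
        + (γ • (Lc * Kp⁻¹ * LR) + Kv).map (fun x => (x : ℂ))
    (∀ s : ℂ,
        (s • (1 : Matrix (Fin n ⊕ Fin n) (Fin n ⊕ Fin n) ℂ) - A').det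
          = ((E * Kp).map (fun x => (x : ℂ))).det * (Q s).det) ∧
      (∀ s : ℂ, s ∈ spectrum ℂ A' ↔ (Q s).det = 0) := by
  intro Kp C E A A' Q
  have hkpu : IsUnit Kp.det := by
    simp only [Kp, Matrix.det_diagonal]
    exact (Finset.prod_ne_zero_iff.mpr fun i _ => (hkp i).ne').isUnit
  have hcu : IsUnit C.det := by
    simp only [C, Matrix.det_diagonal]
    exact (Finset.prod_ne_zero_iff.mpr fun i _ => (hc i).ne').isUnit
  let φ : Matrix (Fin n) (Fin n) ℝ →+* Matrix (Fin n) (Fin n) ℂ := Complex.ofRealHom.mapMatrix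
  have hφ : ∀ M : Matrix (Fin n) (Fin n) ℝ, M.map (fun x => (x : ℂ)) = φ M := fun _ => rfl
  have hCE : φ C * φ E = 1 := by
    rw [← map_mul, Matrix.mul_nonsing_inv _ hcu, map_one]
  have hEC : φ E * φ C = 1 := by
    rw [← map_mul, Matrix.nonsing_inv_mul _ hcu, map_one]
  have hPi : φ Kp⁻¹ * φ Kp = 1 := by
    rw [← map_mul, Matrix.nonsing_inv_mul _ hkpu, map_one]
  have hPi' : φ Kp * φ Kp⁻¹ = 1 := by
    rw [← map_mul, Matrix.mul_nonsing_inv _ hkpu, map_one]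
  have hF : φ (E * Kp) * (φ Kp⁻¹ * φ C) = 1 := by
    rw [map_mul, mul_assoc, ← mul_assoc (φ Kp), hPi', one_mul, hEC]
  have key : ∀ s : ℂ,
        (s • (1 : Matrix (Fin n ⊕ Fin n) (Fin n ⊕ Fin n) ℂ) - A').det
          = ((E * Kp).map (fun x => (x : ℂ))).det * (Q s).det := by
    intro s
    have hM : s • (1 : Matrix (Fin n ⊕ Fin n) (Fin n ⊕ Fin n) ℂ) - A' =
        Matrix.fromBlocks (s • 1 + φ (γ • Lc)) (φ Kv - φ (γ • Lc)) (-φ (E * Kp))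
          (s • 1 + φ E * (φ LR + φ Kp)) := by
      have hA : A' = Matrix.fromBlocks (φ (-(γ • Lc))) (φ (γ • Lc - Kv)) (φ (E * Kp))
          (φ (-(E * (LR + Kp)))) := Matrix.fromBlocks_map _ _ _ _ _
      rw [hA, ← Matrix.fromBlocks_one, Matrix.fromBlocks_smul, sub_eq_add_neg,
        Matrix.fromBlocks_neg, Matrix.fromBlocks_add]
      simp only [map_neg, map_sub, map_mul, map_add, neg_neg, neg_sub, smul_zero, zero_add]
    have hQ : Q s = s ^ 2 • (φ Kp⁻¹ * φ C) + s • (φ Kp⁻¹ * φ LR + 1 + φ (γ • Lc) * φ Kp⁻¹ * φ C)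
        + (φ (γ • Lc) * φ Kp⁻¹ * φ LR + φ Kv) := by
      simp only [Q, hφ, ← map_mul, ← map_add, ← map_one φ, smul_mul_assoc]
    rw [hM, aux_det _ _ _ _ _ _ hF rfl, aux_alg _ _ _ _ _ _ _ _ hCE hPi, hQ, hφ]
  refine ⟨key, fun s => ?_⟩
  have hne : ((E * Kp).map (fun x => (x : ℂ))).det ≠ 0 := by
    intro h0
    have := congrArg Matrix.det hF
    rw [Matrix.det_mul, ← hφ, h0, zero_mul, Matrix.det_one] at this
    exact zero_ne_one this
  rw [spectrum.mem_iff, Matrix.isUnit_iff_isUnit_det, isUnit_iff_ne_zero, not_not,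
    Algebra.algebraMap_eq_smul_one, key s, mul_eq_zero, or_iff_right hne]
end
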